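/- Let τ ∈ (0,1), ν > -1/2 and N ≥ 1 be an integer. Define f_N(z,w) := −∑_{k=0}^{N-1}∑_{j=0}^{k} ((2k)!!·(2j−1)!!·τ^{2k+2j+1}/(2^{k+j}·Γ(k+ν+3/2)·Γ(j+ν+1)))·L_{2k+1}^{(2ν)}(2z/τ)·L_{2j}^{(2ν)}(2w/τ). Then for all z,w ∈ ℂ, applying the differential operator in the variable z to the function z ↦ f_N(w,z): ((1−τ²)/2)·z·∂_z²f_N(w,z) + ( (2ν+1)(1−τ²)/2 + 2τz )·∂_zf_N(w,z) + ( τ(2ν+1) − 2z )·f_N(w,z) = −(2^{2ν+1}/√π)·∑_{k=0}^{N-1} ((2k+1)!·τ^{4k+2}/Γ(2k+2ν+2))·L_{2k+1}^{(2ν)}(2w/τ)·L_{2k+1}^{(2ν)}(2z/τ). -/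

import Mathlib

open MeasureTheory

/-- Generalized Laguerre polynomial `L_j^{(ν)}(z)`. -/
noncomputable def laguerre (ν : ℝ) (j : ℕ) (z : ℂ) : ℂ :=
  ∑ k ∈ Finset.range (j + 1),
    ((Real.Gamma ((j : ℝ) + ν + 1) /
        (((j - k).factorial : ℝ) * Real.Gamma (ν + (k : ℝ) + 1)) : ℝ) : ℂ) *
      (-z) ^ k / ((k.factorial : ℝ) : ℂ)

/-- `f_N(z,w)` of the proof of Theorem 1.1 (ii). -/
noncomputable def fN (τ ν : ℝ) (N : ℕ) (z w : ℂ) : ℂ :=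
  -∑ k ∈ Finset.range N, ∑ j ∈ Finset.range (k + 1),
    ((((2 : ℝ) ^ k * (k.factorial : ℝ)) *
          (((2 * j).factorial : ℝ) / ((2 : ℝ) ^ j * (j.factorial : ℝ))) *
          τ ^ (2 * k + 2 * j + 1) /
        ((2 : ℝ) ^ (k + j) * Real.Gamma ((k : ℝ) + ν + 3 / 2) *
          Real.Gamma ((j : ℝ) + ν + 1)) : ℝ) : ℂ) *
      laguerre (2 * ν) (2 * k + 1) (2 * z / (τ : ℂ)) *
      laguerre (2 * ν) (2 * j) (2 * w / (τ : ℂ))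

/-- The coefficient of `z ^ k` in the generalized Laguerre polynomial of degree `n`. -/
noncomputable def laguerreCoeff (a : ℝ) (n k : ℕ) : ℝ :=
  if k ≤ n then
    (-1) ^ k * Real.Gamma (n + a + 1) / ((n - k).factorial * Real.Gamma (a + k + 1) * k.factorial)
  else 0

theorem laguerreCoeff_add (a : ℝ) (k d : ℕ) :
    laguerreCoeff a (k + d) k = (-1) ^ k * Real.Gamma (k + d + a + 1) /
      (d.factorial * Real.Gamma (a + k + 1) * k.factorial) := by
  simp [laguerreCoeff]

theorem laguerreCoeff_of_lt (a : ℝ) {n k : ℕ} (h : n < k) : laguerreCoeff a n k = 0 := by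
  simp [laguerreCoeff, h]

theorem laguerreCoeff_succ_left {a : ℝ} (ha : -1 < a) (n k : ℕ) :
    ((n : ℝ) + 1 - k) * laguerreCoeff a (n + 1) k = (n + 1 + a) * laguerreCoeff a n k := by
  rcases lt_trichotomy k (n + 1) with h | rfl | h
  · obtain ⟨d, rfl⟩ := Nat.exists_eq_add_of_le (Nat.lt_succ_iff.mp h)
    rw [add_assoc k d 1, laguerreCoeff_add, laguerreCoeff_add]
    have hk : Real.Gamma (a + k + 1) ≠ 0 := (Real.Gamma_pos_of_pos (by linarith [k.cast_nonneg (α := ℝ)])).ne'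
    have hg := Real.Gamma_add_one (s := (k : ℝ) + d + a + 1)
      (by linarith [k.cast_nonneg (α := ℝ), d.cast_nonneg (α := ℝ)])
    push_cast [Nat.factorial_succ]
    rw [show (k : ℝ) + (d + 1) + a + 1 = k + d + a + 1 + 1 by ring, hg]
    field_simp
    ring
  · simp [laguerreCoeff_of_lt a (Nat.lt_succ_self n)]
  · simp [laguerreCoeff_of_lt a h, laguerreCoeff_of_lt a (show n < k by omega)]

theorem laguerreCoeff_succ_right {a : ℝ} (ha : -1 < a) (n k : ℕ) :
    ((k : ℝ) + 1) * (k + a + 1) * laguerreCoeff a n (k + 1) = (k - n) * laguerreCoeff a n k := by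
  rcases lt_trichotomy k n with h | rfl | h
  · obtain ⟨d, rfl⟩ := Nat.exists_eq_add_of_lt h
    have e := laguerreCoeff_add a (k + 1) d
    rw [show k + 1 + d = k + d + 1 by ring] at e
    rw [e, add_assoc k d 1, laguerreCoeff_add]
    have hk : Real.Gamma (a + k + 1) ≠ 0 := (Real.Gamma_pos_of_pos (by linarith [k.cast_nonneg (α := ℝ)])).ne'
    have hk0 : a + k + 1 ≠ 0 := (by linarith [k.cast_nonneg (α := ℝ)] : (0 : ℝ) < a + k + 1).ne'
    have hg := Real.Gamma_add_one (s := a + k + 1) hk0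
    push_cast [Nat.factorial_succ]
    rw [show a + ((k : ℝ) + 1) + 1 = a + k + 1 + 1 by ring, hg,
      show (k : ℝ) + 1 + d + a + 1 = k + (d + 1) + a + 1 by ring]
    field_simp
    ring
  · simp [laguerreCoeff_of_lt a (Nat.lt_succ_self k)]
  · simp [laguerreCoeff_of_lt a h, laguerreCoeff_of_lt a (show n < k + 1 by omega)]

theorem laguerreCoeff_succ_succ_sub {a : ℝ} (ha : -1 < a) (n k : ℕ) :
    ((k : ℝ) + 1) * (laguerreCoeff a (n + 1) (k + 1) - laguerreCoeff a n (k + 1)) =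
      -laguerreCoeff a n k := by
  have hk0 : a + k + 1 ≠ 0 := (by linarith [k.cast_nonneg (α := ℝ)] : (0 : ℝ) < a + k + 1).ne'
  have h₁ := laguerreCoeff_succ_left ha n k
  have h₂ := laguerreCoeff_succ_right ha n k
  have h₃ := laguerreCoeff_succ_right ha (n + 1) k
  push_cast at h₃
  apply mul_left_cancel₀ hk0
  linear_combination h₃ - h₂ - h₁

section

open Polynomial

/-- The generalized Laguerre polynomial of degree `n` as a formal polynomial. -/
noncomputable def laguerrePoly (a : ℝ) (n : ℕ) : ℂ[X] :=
  ∑ k ∈ Finset.range (n + 1), monomial k (laguerreCoeff a n k : ℂ)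

theorem coeff_laguerrePoly (a : ℝ) (n k : ℕ) :
    (laguerrePoly a n).coeff k = laguerreCoeff a n k := by
  simp only [laguerrePoly, finsetSum_coeff, coeff_monomial, Finset.sum_ite_eq', Finset.mem_range]
  split_ifs with h
  · rfl
  · rw [laguerreCoeff_of_lt a (by omega), Complex.ofReal_zero]

theorem laguerre_eq_eval (a : ℝ) (n : ℕ) (z : ℂ) :
    laguerre a n z = (laguerrePoly a n).eval z := by
  simp only [laguerre, laguerrePoly, eval_finsetSum, eval_monomial]
  refine Finset.sum_congr rfl fun k hk => ?_
  rw [laguerreCoeff, if_pos (Finset.mem_range_succ_iff.mp hk), neg_pow z]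
  push_cast
  ring

theorem X_mul_derivative_laguerrePoly_succ {a : ℝ} (ha : -1 < a) (n : ℕ) :
    X * derivative (laguerrePoly a (n + 1)) =
      C ((n : ℂ) + 1) * laguerrePoly a (n + 1) - C ((n : ℂ) + 1 + a) * laguerrePoly a n := by
  ext k
  have h := congrArg (fun x : ℝ => (x : ℂ)) (laguerreCoeff_succ_left ha n k)
  rcases k with _ | k
  · simp only [coeff_sub, coeff_C_mul, coeff_laguerrePoly, coeff_X_mul_zero]
    push_cast at h
    linear_combination -h
  · simp only [coeff_sub, coeff_C_mul, coeff_laguerrePoly, coeff_X_mul, coeff_derivative]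
    push_cast at h
    linear_combination -h

theorem X_mul_derivative_laguerrePoly {a : ℝ} (ha : -1 < a) (n : ℕ) :
    X * derivative (laguerrePoly a n) =
      C ((n : ℂ) + 1) * laguerrePoly a (n + 1) - C ((n : ℂ) + 1 + a) * laguerrePoly a n
        + X * laguerrePoly a n := by
  ext k
  have h := congrArg (fun x : ℝ => (x : ℂ)) (laguerreCoeff_succ_left ha n k)
  rcases k with _ | k
  · simp only [coeff_sub, coeff_add, coeff_C_mul, coeff_laguerrePoly, coeff_X_mul_zero]
    push_cast at h
    linear_combination -h
  · have h' := congrArg (fun x : ℝ => (x : ℂ)) (laguerreCoeff_succ_succ_sub ha n k)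
    simp only [coeff_sub, coeff_add, coeff_C_mul, coeff_laguerrePoly, coeff_X_mul,
      coeff_derivative]
    push_cast at h h'
    linear_combination -h - h'

/-- Laguerre's differential equation. -/
theorem laguerrePoly_differential_equation {a : ℝ} (ha : -1 < a) (n : ℕ) :
    X * derivative (derivative (laguerrePoly a n)) + C ((a : ℂ) + 1) * derivative (laguerrePoly a n)
      = X * derivative (laguerrePoly a n) - C (n : ℂ) * laguerrePoly a n := by
  ext k
  have h := congrArg (fun x : ℝ => (x : ℂ)) (laguerreCoeff_succ_right ha n k)
  rcases k with _ | k
  · simp only [coeff_sub, coeff_add, coeff_C_mul, coeff_laguerrePoly, coeff_X_mul_zero,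
      coeff_derivative]
    push_cast at h ⊢
    linear_combination h
  · simp only [coeff_sub, coeff_add, coeff_C_mul, coeff_laguerrePoly, coeff_X_mul,
      coeff_derivative]
    push_cast at h ⊢
    linear_combination h

/-- The differential operator of the theorem in the rescaled variable, multiplied by `t`. -/
noncomputable def rescaledOperator (t a : ℂ) : ℂ[X] →ₗ[ℂ] ℂ[X] where
  toFun p := C (1 - t ^ 2) * (X * derivative (derivative p) + C (a + 1) * derivative p)
    + C (2 * t ^ 2) * (X * derivative p) + C (t ^ 2) * (C (a + 1) * p - X * p)
  map_add' p q := by simp only [map_add]; ring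
  map_smul' c p := by simp only [smul_eq_C_mul, derivative_C_mul, RingHom.id_apply]; ring

theorem rescaledOperator_apply (t a : ℂ) (p : ℂ[X]) :
    rescaledOperator t a p =
      C (1 - t ^ 2) * (X * derivative (derivative p) + C (a + 1) * derivative p)
        + C (2 * t ^ 2) * (X * derivative p) + C (t ^ 2) * (C (a + 1) * p - X * p) := rfl

theorem rescaledOperator_laguerrePoly_zero {a : ℝ} (ha : -1 < a) (t : ℂ) :
    rescaledOperator t a (laguerrePoly a 0) = C (t ^ 2) * laguerrePoly a 1 := by
  have h₁ := X_mul_derivative_laguerrePoly ha 0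
  have h₂ : derivative (laguerrePoly a 0) = 0 := by simp [laguerrePoly]
  rw [rescaledOperator_apply]
  simp only [h₂, map_zero, mul_zero, map_add, map_one, Nat.cast_zero, zero_add, one_mul, add_zero]
    at h₁ ⊢
  linear_combination C (t ^ 2) * h₁

theorem rescaledOperator_laguerrePoly_succ {a : ℝ} (ha : -1 < a) (t : ℂ) (n : ℕ) :
    rescaledOperator t a (laguerrePoly a (n + 1)) =
      C (t ^ 2 * (n + 2)) * laguerrePoly a (n + 2) - C ((n : ℂ) + 1 + a) * laguerrePoly a n := by
  have h₁ := X_mul_derivative_laguerrePoly ha (n + 1)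
  have h₂ := X_mul_derivative_laguerrePoly_succ ha n
  have h₃ := laguerrePoly_differential_equation ha (n + 1)
  rw [rescaledOperator_apply, h₃]
  rw [show n + 1 + 1 = n + 2 from rfl] at h₁
  simp only [map_add, map_sub, map_mul, map_pow, map_one, Nat.cast_add, Nat.cast_one,
    show (C (2 : ℂ)) = (2 : ℂ[X]) from rfl] at h₁ h₂ ⊢
  linear_combination C t ^ 2 * h₁ + h₂

/-- The coefficients of the even Laguerre polynomials in the kernel. -/
noncomputable def evenWeight (ν : ℝ) (j : ℕ) : ℝ :=
  ((2 * j).factorial : ℝ) / (2 ^ j * j.factorial) / (2 ^ j * Real.Gamma (j + ν + 1))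

theorem evenWeight_succ {ν : ℝ} (hν : -(1 / 2 : ℝ) < ν) (j : ℕ) :
    evenWeight ν (j + 1) * (2 * j + 2 + 2 * ν) = evenWeight ν j * (2 * j + 1) := by
  have hj : (0 : ℝ) ≤ j := j.cast_nonneg
  have h0 : (j : ℝ) + ν + 1 ≠ 0 := by linarith
  have hG : Real.Gamma (j + ν + 1) ≠ 0 := (Real.Gamma_pos_of_pos (by linarith)).ne'
  have hg := Real.Gamma_add_one h0
  simp only [evenWeight, show 2 * (j + 1) = 2 * j + 1 + 1 by ring, Nat.factorial_succ]
  push_cast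
  rw [show (j : ℝ) + 1 + ν + 1 = j + ν + 1 + 1 by ring, hg]
  field_simp
  ring

theorem rescaledOperator_sum_laguerrePoly {ν : ℝ} (hν : -(1 / 2 : ℝ) < ν) (t : ℂ) (k : ℕ) :
    rescaledOperator t (2 * ν : ℝ) (∑ j ∈ Finset.range (k + 1),
        ((evenWeight ν j : ℂ) * t ^ (2 * j)) • laguerrePoly (2 * ν) (2 * j)) =
      ((evenWeight ν k : ℂ) * t ^ (2 * k + 2) * (2 * k + 1)) •
        laguerrePoly (2 * ν) (2 * k + 1) := by
  have ha : -1 < 2 * ν := by linarith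
  induction k with
  | zero =>
    have h := rescaledOperator_laguerrePoly_zero ha t
    simp only [zero_add, Finset.sum_range_one, mul_zero, pow_zero, mul_one, map_smul, h,
      Nat.cast_zero]
    simp only [smul_eq_C_mul, map_mul, mul_assoc]
  | succ k ih =>
    have hw := congrArg (fun x : ℝ => C (x : ℂ)) (evenWeight_succ hν k)
    have hs := rescaledOperator_laguerrePoly_succ ha t (2 * k + 1)
    rw [Finset.sum_range_succ, map_add, ih, map_smul, show 2 * (k + 1) = 2 * k + 1 + 1 by ring, hs]
    simp only [smul_eq_C_mul, map_add, map_mul, map_pow, map_one, Complex.ofReal_add,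
      Complex.ofReal_mul, Complex.ofReal_natCast, Complex.ofReal_one, Complex.ofReal_ofNat,
      Nat.cast_add, Nat.cast_mul, Nat.cast_one, Nat.cast_ofNat,
      show (C (2 : ℂ)) = (2 : ℂ[X]) from rfl] at hw ⊢
    linear_combination -C t ^ (2 * k + 2) * laguerrePoly (2 * ν) (2 * k + 1) * hw

theorem deriv_eval_mul_left (p : ℂ[X]) (s : ℂ) :
    deriv (fun z => p.eval (s * z)) = fun z => s * (derivative p).eval (s * z) := by
  ext z
  have h := (p.hasDerivAt (s * z)).comp z ((hasDerivAt_id z).const_mul s)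
  simpa [mul_comm, Function.comp_def] using h.deriv

/-- The coefficients of the odd Laguerre polynomials in the kernel. -/
noncomputable def oddWeight (ν : ℝ) (k : ℕ) : ℝ :=
  k.factorial / Real.Gamma (k + ν + 3 / 2)

theorem oddWeight_mul_evenWeight {ν : ℝ} (hν : -(1 / 2 : ℝ) < ν) (k : ℕ) :
    oddWeight ν k * evenWeight ν k * (2 * k + 1) =
      2 ^ (2 * ν + 1) / Real.sqrt Real.pi *
        ((2 * k + 1).factorial / Real.Gamma (2 * k + 2 * ν + 2)) := by
  have hk : (0 : ℝ) ≤ k := k.cast_nonneg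
  have h₁ : Real.Gamma (k + ν + 1) ≠ 0 := (Real.Gamma_pos_of_pos (by linarith)).ne'
  have h₂ : Real.Gamma (k + ν + 3 / 2) ≠ 0 := (Real.Gamma_pos_of_pos (by linarith)).ne'
  have h₃ : Real.Gamma (2 * k + 2 * ν + 2) ≠ 0 := (Real.Gamma_pos_of_pos (by linarith)).ne'
  have h₄ : Real.sqrt Real.pi ≠ 0 := (Real.sqrt_pos.mpr Real.pi_pos).ne'
  have hd := Real.Gamma_mul_Gamma_add_half (k + ν + 1)
  rw [show (k : ℝ) + ν + 1 + 1 / 2 = k + ν + 3 / 2 by ring,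
    show 2 * ((k : ℝ) + ν + 1) = 2 * k + 2 * ν + 2 by ring] at hd
  have hp : (2 : ℝ) ^ (2 * ν + 1) * 2 ^ (1 - (2 * (k : ℝ) + 2 * ν + 2)) * (2 ^ k * 2 ^ k) = 1 := by
    rw [← Real.rpow_natCast, ← Real.rpow_add two_pos, ← Real.rpow_add two_pos,
      ← Real.rpow_add two_pos]
    ring_nf
    exact Real.rpow_zero 2
  simp only [oddWeight, evenWeight, Nat.factorial_succ]
  push_cast
  generalize Real.Gamma (k + ν + 1) = A at *
  generalize Real.Gamma (k + ν + 3 / 2) = B at *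
  generalize Real.Gamma (2 * k + 2 * ν + 2) = D at *
  generalize (2 : ℝ) ^ (2 * ν + 1) = P at *
  field_simp
  linear_combination (-P * (2 ^ k * 2 ^ k)) * hd - D * Real.sqrt Real.pi * hp

theorem fN_eq_eval (τ ν : ℝ) (N : ℕ) (w z : ℂ) :
    fN τ ν N w z = (-∑ k ∈ Finset.range N,
      ((oddWeight ν k : ℂ) * τ ^ (2 * k + 1) * laguerre (2 * ν) (2 * k + 1) (2 * w / τ)) •
        ∑ j ∈ Finset.range (k + 1),
          ((evenWeight ν j : ℂ) * (τ : ℂ) ^ (2 * j)) • laguerrePoly (2 * ν) (2 * j)).eval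
            (2 / τ * z) := by
  simp only [fN, eval_neg, eval_finsetSum, eval_smul, smul_eq_mul, Finset.mul_sum,
    ← laguerre_eq_eval, div_mul_eq_mul_div]
  congr 1
  refine Finset.sum_congr rfl fun k _ => Finset.sum_congr rfl fun j _ => ?_
  simp only [oddWeight, evenWeight]
  push_cast
  field_simp
  ring


end

/-- The differential equation (3.9) satisfied by `z ↦ f_N(w,z)`. -/
theorem stmt_14 (τ ν : ℝ) (hτ : τ ∈ Set.Ioo (0 : ℝ) 1) (hν : -(1 / 2 : ℝ) < ν)
    (N : ℕ) (hN : 1 ≤ N) (z w : ℂ) :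
    ((1 - (τ : ℂ) ^ 2) / 2) * z * deriv (deriv (fun z' => fN τ ν N w z')) z
      + ((2 * (ν : ℂ) + 1) * (1 - (τ : ℂ) ^ 2) / 2 + 2 * (τ : ℂ) * z) *
          deriv (fun z' => fN τ ν N w z') z
      + ((τ : ℂ) * (2 * (ν : ℂ) + 1) - 2 * z) * fN τ ν N w z
    = -(((2 : ℝ) ^ (2 * ν + 1) / Real.sqrt Real.pi : ℝ) : ℂ) *
        ∑ k ∈ Finset.range N,
          ((((2 * k + 1).factorial : ℝ) * τ ^ (4 * k + 2) /
              Real.Gamma (2 * (k : ℝ) + 2 * ν + 2) : ℝ) : ℂ) *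
            laguerre (2 * ν) (2 * k + 1) (2 * w / (τ : ℂ)) *
            laguerre (2 * ν) (2 * k + 1) (2 * z / (τ : ℂ)) := by
  have hτ0 : (τ : ℂ) ≠ 0 := Complex.ofReal_ne_zero.mpr hτ.1.ne'
  simp only [fN_eq_eval, deriv_eval_mul_left, deriv_const_mul_field]
  set Q : Polynomial ℂ := -∑ k ∈ Finset.range N,
      ((oddWeight ν k : ℂ) * τ ^ (2 * k + 1) * laguerre (2 * ν) (2 * k + 1) (2 * w / τ)) •
        ∑ j ∈ Finset.range (k + 1),
          ((evenWeight ν j : ℂ) * (τ : ℂ) ^ (2 * j)) • laguerrePoly (2 * ν) (2 * j) with hQ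
  trans (1 / τ) * (rescaledOperator τ (2 * ν : ℝ) Q).eval (2 / τ * z)
  · rw [rescaledOperator_apply]
    simp only [Polynomial.eval_add, Polynomial.eval_sub, Polynomial.eval_mul, Polynomial.eval_C, Polynomial.eval_X]
    push_cast
    field_simp
    ring
  · simp only [hQ, map_neg, map_sum, map_smul, rescaledOperator_sum_laguerrePoly hν, Polynomial.eval_neg,
      Polynomial.eval_finsetSum, Polynomial.eval_smul, smul_eq_mul]
    rw [mul_neg, neg_mul, Finset.mul_sum, Finset.mul_sum]
    congr 1
    refine Finset.sum_congr rfl fun k _ => ?_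
    have hw := congrArg (fun x : ℝ => (x : ℂ)) (oddWeight_mul_evenWeight hν k)
    rw [laguerre_eq_eval _ _ (2 * z / (τ : ℂ)), mul_div_right_comm 2 z (τ : ℂ)]
    simp only [Complex.ofReal_mul, Complex.ofReal_add, Complex.ofReal_div, Complex.ofReal_pow,
      Complex.ofReal_natCast, Complex.ofReal_one, Complex.ofReal_ofNat] at hw ⊢
    apply mul_left_cancel₀ hτ0
    rw [← mul_assoc, mul_one_div_cancel hτ0, one_mul]
    linear_combination (τ : ℂ) ^ (4 * k + 3) * laguerre (2 * ν) (2 * k + 1) (2 * w / τ) *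
      (laguerrePoly (2 * ν) (2 * k + 1)).eval (2 / τ * z) * hw
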